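/- Let L be a finite-dimensional Lie algebra over a field 𝔽 and let 0 → R → F →π→ L → 0 be a free presentation of L. Then H²(L, 𝔽) ≅ (F² ∩ R)/⁅F,R⁆ as 𝔽-vector spaces; in particular the Schur multiplier M(L) = (F² ∩ R)/⁅F,R⁆ is isomorphic to the second cohomology group H²(L, 𝔽) of L with coefficients in the trivial module 𝔽. -/

import Mathlib

set_option maxSynthPendingDepth 3

/-- The canonical quotient map `L → L ⧸ I` by a Lie ideal, as a Lie algebra homomorphism. -/
def lieQuotMk {R L : Type*} [CommRing R] [LieRing L] [LieAlgebra R L]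
    (I : LieIdeal R L) : L →ₗ⁅R⁆ L ⧸ I :=
  { I.toSubmodule.mkQ with map_lie' := rfl }

variable (𝔽 A : Type*) [Field 𝔽] [LieRing A] [LieAlgebra 𝔽 A]

/-- `Z²(A,𝔽)`: the alternating bilinear 2-cocycles on `A` with values in the trivial
module `𝔽`, i.e. bilinear `g` with `g x x = 0` and
`g ⁅x,y⁆ z + g ⁅y,z⁆ x + g ⁅z,x⁆ y = 0`. -/
def lieZ2 : Submodule 𝔽 (A →ₗ[𝔽] A →ₗ[𝔽] 𝔽) where
  carrier := {g | (∀ x : A, g x x = 0) ∧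
    ∀ x y z : A, g ⁅x, y⁆ z + g ⁅y, z⁆ x + g ⁅z, x⁆ y = 0}
  add_mem' := by
    rintro a b ⟨ha1, ha2⟩ ⟨hb1, hb2⟩
    refine ⟨fun x => ?_, fun x y z => ?_⟩
    · simp [ha1 x, hb1 x]
    · have h1 := ha2 x y z
      have h2 := hb2 x y z
      simp only [LinearMap.add_apply]
      linear_combination h1 + h2
  zero_mem' := by
    refine ⟨fun x => ?_, fun x y z => ?_⟩ <;> simp
  smul_mem' := by
    rintro c a ⟨ha1, ha2⟩
    refine ⟨fun x => ?_, fun x y z => ?_⟩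
    · simp [ha1 x]
    · have h := ha2 x y z
      simp only [LinearMap.smul_apply, smul_eq_mul]
      linear_combination c * h

/-- `B²(A,𝔽)`: the 2-coboundaries `(x,y) ↦ -σ ⁅x,y⁆` (for linear `σ : A → 𝔽`), as a
subspace of `Z²(A,𝔽)`. -/
def lieB2 : Submodule 𝔽 (lieZ2 𝔽 A) where
  carrier := {g | ∃ σ : A →ₗ[𝔽] 𝔽,
    ∀ x y : A, (g : A →ₗ[𝔽] A →ₗ[𝔽] 𝔽) x y = -σ ⁅x, y⁆}
  add_mem' := by
    rintro a b ⟨σa, ha⟩ ⟨σb, hb⟩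
    exact ⟨σa + σb, fun x y => by
      simp [Submodule.coe_add, LinearMap.add_apply, ha x y, hb x y]; ring⟩
  zero_mem' := ⟨0, fun x y => by simp⟩
  smul_mem' := by
    rintro c a ⟨σ, ha⟩
    exact ⟨c • σ, fun x y => by
      simp [Submodule.coe_smul, LinearMap.smul_apply, ha x y]⟩

/-- `H²(A,𝔽) = Z²(A,𝔽)/B²(A,𝔽)`: the second cohomology group of `A` with coefficients
in the trivial module `𝔽`. -/
abbrev lieH2 := (↥(lieZ2 𝔽 A)) ⧸ lieB2 𝔽 A

/-- The central extension of `A` by `𝔽` attached to a 2-cocycle `g`: the space `A × 𝔽` with the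
bracket `⁅(x, a), (y, b)⁆ = (⁅x, y⁆, g x y)`. -/
def LieCocycleExtension {𝔽 A : Type*} [Field 𝔽] [LieRing A] [LieAlgebra 𝔽 A]
    (_g : lieZ2 𝔽 A) : Type _ := A × 𝔽

namespace LieCocycleExtension

variable {𝔽 A : Type*} [Field 𝔽] [LieRing A] [LieAlgebra 𝔽 A] (g : lieZ2 𝔽 A)

instance : AddCommGroup (LieCocycleExtension g) := inferInstanceAs (AddCommGroup (A × 𝔽))

instance : Module 𝔽 (LieCocycleExtension g) := inferInstanceAs (Module 𝔽 (A × 𝔽))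

instance : LieRing (LieCocycleExtension g) where
  bracket x y := (⁅x.1, y.1⁆, g.1 x.1 y.1)
  add_lie x y z := Prod.ext (add_lie x.1 y.1 z.1) (by
    change g.1 (x.1 + y.1) z.1 = g.1 x.1 z.1 + g.1 y.1 z.1
    simp)
  lie_add x y z := Prod.ext (lie_add x.1 y.1 z.1) (map_add (g.1 x.1) y.1 z.1)
  lie_self x := Prod.ext (lie_self x.1) (g.2.1 x.1)
  leibniz_lie x y z := Prod.ext (leibniz_lie x.1 y.1 z.1) (by
    change g.1 x.1 ⁅y.1, z.1⁆ = g.1 ⁅x.1, y.1⁆ z.1 + g.1 y.1 ⁅x.1, z.1⁆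
    have skew := LinearMap.IsAlt.neg g.2.1
    have cocycle := g.2.2 x.1 y.1 z.1
    have swap : g.1 ⁅z.1, x.1⁆ y.1 = g.1 y.1 ⁅x.1, z.1⁆ := by
      rw [← skew, ← lie_skew, map_neg, neg_neg]
    rw [swap, ← skew x.1 ⁅y.1, z.1⁆] at cocycle
    linear_combination -cocycle)

instance : LieAlgebra 𝔽 (LieCocycleExtension g) where
  lie_smul t x y := Prod.ext (lie_smul t x.1 y.1) (map_smul (g.1 x.1) t y.1)

/-- The projection of the central extension onto `A`. -/
def fstHom : LieCocycleExtension g →ₗ⁅𝔽⁆ A :=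
  { LinearMap.fst 𝔽 A 𝔽 with map_lie' := rfl }

/-- The linear projection of the central extension onto its kernel `𝔽`. -/
def sndLinear : LieCocycleExtension g →ₗ[𝔽] 𝔽 := LinearMap.snd 𝔽 A 𝔽

theorem sndLinear_lie (x y : LieCocycleExtension g) :
    sndLinear g ⁅x, y⁆ = g.1 (fstHom g x) (fstHom g y) := rfl

end LieCocycleExtension

/-- The pullback of a 2-cocycle to a free Lie algebra is a coboundary. -/
theorem FreeLieAlgebra.exists_dual_lie_eq_cocycle {𝔽 X L : Type*} [Field 𝔽] [LieRing L]
    [LieAlgebra 𝔽 L] (π : FreeLieAlgebra 𝔽 X →ₗ⁅𝔽⁆ L) (g : lieZ2 𝔽 L) :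
    ∃ h : FreeLieAlgebra 𝔽 X →ₗ[𝔽] 𝔽, ∀ x y, h ⁅x, y⁆ = g.1 (π x) (π y) := by
  let φ : FreeLieAlgebra 𝔽 X →ₗ⁅𝔽⁆ LieCocycleExtension g :=
    FreeLieAlgebra.lift 𝔽 fun x => ((π (FreeLieAlgebra.of 𝔽 x), 0) : L × 𝔽)
  have hφ : (LieCocycleExtension.fstHom g).comp φ = π := by
    refine FreeLieAlgebra.hom_ext fun x => ?_
    rw [LieHom.comp_apply, show φ (FreeLieAlgebra.of 𝔽 x) = _ from FreeLieAlgebra.lift_of_apply ..]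
    rfl
  refine ⟨LieCocycleExtension.sndLinear g ∘ₗ φ.toLinearMap, fun x y => ?_⟩
  rw [← hφ]
  change LieCocycleExtension.sndLinear g (φ ⁅x, y⁆) = _
  rw [LieHom.map_lie, LieCocycleExtension.sndLinear_lie]
  rfl

section CentralExtension

variable {𝔽 Q L : Type*} [Field 𝔽] [LieRing Q] [LieAlgebra 𝔽 Q] [LieRing L] [LieAlgebra 𝔽 L]
  (p : Q →ₗ⁅𝔽⁆ L)

theorem lie_congr_of_central_ker (hc : ∀ x y : Q, p y = 0 → ⁅x, y⁆ = 0) {x x' y y' : Q}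
    (hx : p x = p x') (hy : p y = p y') : ⁅x, y⁆ = ⁅x', y'⁆ := by
  have h₁ : ⁅x, y - y'⁆ = 0 := hc _ _ (by simp [hy])
  have h₂ : ⁅y', x - x'⁆ = 0 := hc _ _ (by simp [hx])
  rw [lie_sub, sub_eq_zero] at h₁ h₂
  rw [h₁, ← lie_skew, h₂, lie_skew]

/-- A linear section `s` of a central extension `p : Q → L` turns a functional `f` on `Q` into the
2-cocycle `(a, b) ↦ f ⁅s a, s b⁆` on `L`. -/
def dualToLieZ2 (hc : ∀ x y : Q, p y = 0 → ⁅x, y⁆ = 0) (s : L →ₗ[𝔽] Q) (hs : ∀ a, p (s a) = a) :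
    Module.Dual 𝔽 Q →ₗ[𝔽] lieZ2 𝔽 L where
  toFun f := ⟨LinearMap.mk₂ 𝔽 (fun a b => f ⁅s a, s b⁆) (by simp) (by simp) (by simp) (by simp), by
    refine ⟨fun x => by simp, fun x y z => ?_⟩
    have hlie (a b c : L) : ⁅s ⁅a, b⁆, s c⁆ = ⁅⁅s a, s b⁆, s c⁆ :=
      lie_congr_of_central_ker p hc (by simp [hs]) rfl
    simp only [LinearMap.mk₂_apply, hlie, ← map_add]
    have hjac : ⁅⁅s x, s y⁆, s z⁆ + ⁅⁅s y, s z⁆, s x⁆ + ⁅⁅s z, s x⁆, s y⁆ = 0 := by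
      rw [← lie_skew ⁅s x, s y⁆, ← lie_skew ⁅s y, s z⁆, ← lie_skew ⁅s z, s x⁆, ← neg_add,
        ← neg_add, neg_eq_zero, add_rotate]
      exact lie_jacobi (s x) (s y) (s z)
    rw [hjac, map_zero]⟩
  map_add' f f' := rfl
  map_smul' t f := rfl

theorem dualToLieZ2_apply (hc : ∀ x y : Q, p y = 0 → ⁅x, y⁆ = 0) (s : L →ₗ[𝔽] Q)
    (hs : ∀ a, p (s a) = a) (f : Module.Dual 𝔽 Q) (a b : L) :
    (dualToLieZ2 p hc s hs f).1 a b = f ⁅s a, s b⁆ := rfl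

/-- If every 2-cocycle on `L` becomes a coboundary on the central extension `Q`, then `H²(L, 𝔽)` is
the dual of the intersection of the kernel with the derived subalgebra. -/
theorem nonempty_lieH2_equiv_dual (hp : Function.Surjective p)
    (hc : ∀ x y : Q, p y = 0 → ⁅x, y⁆ = 0)
    (hlift : ∀ g : lieZ2 𝔽 L, ∃ h : Q →ₗ[𝔽] 𝔽, ∀ x y, h ⁅x, y⁆ = g.1 (p x) (p y))
    (M : Submodule 𝔽 Q)
    (hM : M = Submodule.span 𝔽 {z | ∃ x y : Q, ⁅x, y⁆ = z} ⊓ LinearMap.ker p.toLinearMap) :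
    Nonempty (lieH2 𝔽 L ≃ₗ[𝔽] Module.Dual 𝔽 M) := by
  obtain ⟨s, hs'⟩ := p.toLinearMap.exists_rightInverse_of_surjective (LinearMap.range_eq_top.2 hp)
  have hs (a : L) : p (s a) = a := LinearMap.congr_fun hs' a
  let D : Submodule 𝔽 Q := Submodule.span 𝔽 {z | ∃ x y : Q, ⁅x, y⁆ = z}
  let Ψ := (lieB2 𝔽 L).mkQ ∘ₗ dualToLieZ2 p hc s hs
  have hΨ : Function.Surjective Ψ := by
    refine (Submodule.mkQ_surjective _).comp fun g => ?_
    obtain ⟨h, hh⟩ := hlift g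
    refine ⟨h, Subtype.ext (LinearMap.ext₂ fun a b => ?_)⟩
    rw [dualToLieZ2_apply, hh, hs, hs]
  have hρ : Function.Surjective M.dualRestrict := Subspace.dualRestrict_surjective
  have hker : LinearMap.ker Ψ = LinearMap.ker M.dualRestrict := by
    ext f
    have hΨf : f ∈ LinearMap.ker Ψ ↔ ∃ σ : L →ₗ[𝔽] 𝔽, ∀ x y, f ⁅s x, s y⁆ = -σ ⁅x, y⁆ := by
      simp only [LinearMap.mem_ker, Ψ, LinearMap.comp_apply, Submodule.mkQ_apply,
        Submodule.Quotient.mk_eq_zero]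
      rfl
    rw [hΨf, LinearMap.mem_ker]
    constructor
    · rintro ⟨σ, hσ⟩
      have hD : D ≤ LinearMap.ker (f + σ ∘ₗ p.toLinearMap) := by
        refine Submodule.span_le.2 ?_
        rintro _ ⟨x, y, rfl⟩
        have hlie := lie_congr_of_central_ker p hc (hs (p x)) (hs (p y))
        simp [← hlie, hσ, hs]
      ext ⟨z, hz⟩
      rw [hM] at hz
      have h₁ := hD hz.1
      have h₂ : p z = 0 := hz.2
      simpa [h₂] using h₁
    · intro hf
      have hmem : f ∘ₗ D.subtype ∈ LinearMap.range (p.toLinearMap ∘ₗ D.subtype).dualMap := by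
        rw [LinearMap.range_dualMap_eq_dualAnnihilator_ker, Submodule.mem_dualAnnihilator]
        intro z hz
        exact LinearMap.congr_fun hf ⟨z.1, hM ▸ ⟨z.2, hz⟩⟩
      obtain ⟨σ, hσ⟩ := hmem
      refine ⟨-σ, fun x y => ?_⟩
      have h := LinearMap.congr_fun hσ ⟨⁅s x, s y⁆, Submodule.subset_span ⟨_, _, rfl⟩⟩
      simpa [hs] using h.symm
  exact ⟨(Ψ.quotKerEquivOfSurjective hΨ).symm ≪≫ₗ Submodule.quotEquivOfEq _ _ hker ≪≫ₗ
    M.dualRestrict.quotKerEquivOfSurjective hρ⟩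

end CentralExtension

theorem lieQuotMk_surjective {R L : Type*} [CommRing R] [LieRing L] [LieAlgebra R L]
    (I : LieIdeal R L) : Function.Surjective (lieQuotMk I) :=
  Submodule.mkQ_surjective _

/-- Theorem 3.4; purely even case.
Let `L` be a finite-dimensional Lie algebra over a field `𝔽` and let
`0 → R → F →π→ L → 0` be a free presentation of `L` (`F` a free Lie algebra,
`R = ker π`).  Then `H²(L,𝔽) ≅ (F² ∩ R)/⁅F,R⁆` as `𝔽`-vector spaces, where the
multiplier `(F² ∩ R)/⁅F,R⁆` is realized as the image of the ideal `F² ∩ R` in the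
quotient `F/⁅F,R⁆`.  In particular the Schur multiplier `M(L) = (F² ∩ R)/⁅F,R⁆` is
isomorphic to the second cohomology group of `L` with coefficients in the trivial
module `𝔽`. -/
theorem schurMultiplier_iso_H2
    {X L : Type*} [LieRing L] [LieAlgebra 𝔽 L] [FiniteDimensional 𝔽 L]
    (π : FreeLieAlgebra 𝔽 X →ₗ⁅𝔽⁆ L) (hπ : Function.Surjective π) :
    Nonempty
      ((lieH2 𝔽 L) ≃ₗ[𝔽]
        (LieIdeal.map (lieQuotMk ⁅(⊤ : LieIdeal 𝔽 (FreeLieAlgebra 𝔽 X)), π.ker⁆)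
          (⁅(⊤ : LieIdeal 𝔽 (FreeLieAlgebra 𝔽 X)),
            (⊤ : LieIdeal 𝔽 (FreeLieAlgebra 𝔽 X))⁆ ⊓ π.ker))) := by
  set I : LieIdeal 𝔽 (FreeLieAlgebra 𝔽 X) := ⁅(⊤ : LieIdeal 𝔽 (FreeLieAlgebra 𝔽 X)), π.ker⁆
    with hI
  have hmk := lieQuotMk_surjective I
  have hmk0 {r} (hr : r ∈ I) : lieQuotMk I r = 0 := (Submodule.Quotient.mk_eq_zero _).2 hr
  have hIker : I ≤ π.ker := LieSubmodule.lie_le_right _ _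
  let p : (FreeLieAlgebra 𝔽 X ⧸ I) →ₗ⁅𝔽⁆ L :=
    { I.toSubmodule.liftQ π.toLinearMap fun x hx => hIker hx with
      map_lie' := by
        intro x y
        obtain ⟨x, rfl⟩ := hmk x
        obtain ⟨y, rfl⟩ := hmk y
        exact π.map_lie x y }
  have hp (x) : p (lieQuotMk I x) = π x := rfl
  have hpsurj : Function.Surjective p := fun a => (hπ a).imp' (lieQuotMk I) fun _ h => h
  have hc (x y : FreeLieAlgebra 𝔽 X ⧸ I) (hy : p y = 0) : ⁅x, y⁆ = 0 := by
    obtain ⟨x, rfl⟩ := hmk x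
    obtain ⟨y, rfl⟩ := hmk y
    rw [← LieHom.map_lie]
    exact hmk0 (LieSubmodule.lie_mem_lie (LieSubmodule.mem_top x) hy)
  have hlift (g : lieZ2 𝔽 L) :
      ∃ h : (FreeLieAlgebra 𝔽 X ⧸ I) →ₗ[𝔽] 𝔽, ∀ x y, h ⁅x, y⁆ = g.1 (p x) (p y) := by
    obtain ⟨h, hh⟩ := FreeLieAlgebra.exists_dual_lie_eq_cocycle π g
    have hle : I.toSubmodule ≤ LinearMap.ker h := by
      rw [hI, LieSubmodule.lieIdeal_oper_eq_linear_span', Submodule.span_le]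
      rintro _ ⟨x, -, y, hy, rfl⟩
      have hy : π y = 0 := hy
      simp [hh, hy]
    refine ⟨I.toSubmodule.liftQ h hle, fun x y => ?_⟩
    obtain ⟨x, rfl⟩ := hmk x
    obtain ⟨y, rfl⟩ := hmk y
    exact hh x y
  let J := LieIdeal.map (lieQuotMk I) (⁅(⊤ : LieIdeal 𝔽 (FreeLieAlgebra 𝔽 X)),
    (⊤ : LieIdeal 𝔽 (FreeLieAlgebra 𝔽 X))⁆ ⊓ π.ker)
  have hJ : J.toSubmodule = Submodule.span 𝔽 {z | ∃ x y : FreeLieAlgebra 𝔽 X ⧸ I, ⁅x, y⁆ = z} ⊓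
      LinearMap.ker p.toLinearMap := by
    have hspan : Submodule.span 𝔽 {z | ∃ x y : FreeLieAlgebra 𝔽 X ⧸ I, ⁅x, y⁆ = z} =
        (⁅(⊤ : LieIdeal 𝔽 (FreeLieAlgebra 𝔽 X)), (⊤ : LieIdeal 𝔽 (FreeLieAlgebra 𝔽 X))⁆
          ).toSubmodule.map (lieQuotMk I).toLinearMap := by
      rw [LieSubmodule.lieIdeal_oper_eq_linear_span', Submodule.map_span]
      congr 1
      ext z
      constructor
      · rintro ⟨x, y, rfl⟩
        obtain ⟨x, rfl⟩ := hmk x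
        obtain ⟨y, rfl⟩ := hmk y
        exact ⟨⁅x, y⁆, ⟨x, trivial, y, trivial, rfl⟩, rfl⟩
      · rintro ⟨_, ⟨x, -, y, -, rfl⟩, rfl⟩
        exact ⟨lieQuotMk I x, lieQuotMk I y, rfl⟩
    rw [hspan]
    ext z
    constructor
    · intro hz
      obtain ⟨⟨y, hy⟩, rfl⟩ := LieIdeal.mem_map_of_surjective hmk hz
      exact ⟨⟨y, hy.1, rfl⟩, hy.2⟩
    · rintro ⟨⟨y, hy, rfl⟩, hz⟩
      exact LieIdeal.mem_map ⟨hy, hz⟩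
  obtain ⟨e⟩ := nonempty_lieH2_equiv_dual p hpsurj hc hlift J.toSubmodule hJ
  have hfin : FiniteDimensional 𝔽 (Module.Dual 𝔽 J.toSubmodule) := e.finiteDimensional
  have hJfin : FiniteDimensional 𝔽 J.toSubmodule := (Module.finite_dual_iff 𝔽).1 hfin
  obtain ⟨e'⟩ := Basis.linearEquiv_dual_iff_finiteDimensional.2 hJfin
  exact ⟨e ≪≫ₗ e'.symm⟩
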